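/- arXiv:2305.09405 — 5 statements merged into one kernel-verified Lean document; each statement's English description precedes it below -/
import Mathlib

section
/- Suppose q = 4m + 1 is a prime power with m ≥ 2, and let α be a primitive element (generator of the multiplicative group) of the finite field F_q. For 0 ≤ j ≤ m−1, define C_j = {α^{2j}, −α^{2j}}. Then the family (C_0, …, C_{m−1}) is a (q, m, 2; 1)-1-circular external difference family in the additive group of F_q if and only if α⁴ − 1 is a quadratic non-residue in F_q (i.e., α⁴ − 1 is not the square of any element of F_q^×). -/
open Finset

/-- Cyclic shift of an index in `Fin m` by `c` (i.e. `j ↦ (j + c) mod m`). -/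
def cycShift (m c : ℕ) (j : Fin m) : Fin m := ⟨(j.val + c) % m, Nat.mod_lt _ j.pos⟩

/-- `IsCEDF m ℓ lam c A` says that the family `A_0, …, A_{m-1}` of pairwise disjoint
`ℓ`-element subsets of `G` is an `(n, m, ℓ; λ)`-`c`-circular external difference family:
in the multiset union `⋃_{j} D(A_{(j+c) mod m}, A_j)` of external differences,
every nonzero `g ∈ G` occurs exactly `lam` times. -/
def IsCEDF {G : Type*} [AddCommGroup G] [DecidableEq G]
    (m ℓ lam c : ℕ) (A : Fin m → Finset G) : Prop :=
  (∀ i j : Fin m, i ≠ j → Disjoint (A i) (A j)) ∧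
  (∀ i, (A i).card = ℓ) ∧
  (∀ g : G, g ≠ 0 →
    ∑ j : Fin m,
      (((A (cycShift m c j)) ×ˢ (A j)).filter (fun p => p.1 - p.2 = g)).card = lam)

section PrimitiveElement

variable {F : Type*} [Field F] [Fintype F] {m : ℕ} {α : Fˣ}

lemma orderOf_of_primitive (hq : Fintype.card F = 4 * m + 1)
    (hα : ∀ x : Fˣ, x ∈ Subgroup.zpowers α) : orderOf α = 4 * m := by
  rw [orderOf_eq_card_of_forall_mem_zpowers hα, Nat.card_units, Nat.card_eq_fintype_card, hq]
  rfl

lemma orderOf_sq_of_primitive (hq : Fintype.card F = 4 * m + 1)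
    (hα : ∀ x : Fˣ, x ∈ Subgroup.zpowers α) : orderOf ((α : F) ^ 2) = 2 * m := by
  have h := orderOf_of_primitive hq hα
  rw [orderOf_pow_of_dvd two_ne_zero (by rw [orderOf_units, h]; exact ⟨2 * m, by ring⟩),
    orderOf_units, h]
  omega

lemma two_ne_zero_of_card (hq : Fintype.card F = 4 * m + 1) : (2 : F) ≠ 0 := by
  have h : ((Fintype.card F : ℕ) : F) = 0 := Nat.cast_card_eq_zero F
  rw [hq] at h
  push_cast at h
  intro h2
  have : (1 : F) = 0 := by linear_combination h - 2 * (m : F) * h2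
  exact one_ne_zero this

lemma sq_pow_eq_neg_one_of_primitive (hm : 0 < m) (hq : Fintype.card F = 4 * m + 1)
    (hα : ∀ x : Fˣ, x ∈ Subgroup.zpowers α) : ((α : F) ^ 2) ^ m = -1 := by
  have h := orderOf_sq_of_primitive hq hα
  have h1 : (((α : F) ^ 2) ^ m) ^ 2 = 1 := by
    rw [← pow_mul, mul_comm m, ← h, pow_orderOf_eq_one]
  rw [sq] at h1
  exact (mul_self_eq_one_iff.mp h1).resolve_left <| pow_ne_one_of_lt_orderOf hm.ne' (by omega)

lemma isSquare_iff_exists_sq_pow (hm : 0 < m) (hq : Fintype.card F = 4 * m + 1)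
    (hα : ∀ x : Fˣ, x ∈ Subgroup.zpowers α) {h : F} (h0 : h ≠ 0) :
    IsSquare h ↔ ∃ i ∈ range (2 * m), ((α : F) ^ 2) ^ i = h := by
  have ho := orderOf_sq_of_primitive hq hα
  constructor
  · rintro ⟨y, rfl⟩
    have hy : y ≠ 0 := left_ne_zero_of_mul h0
    obtain ⟨k, hk⟩ := (mem_powers_iff_mem_zpowers (x := α)).mpr (hα (Units.mk0 y hy))
    have hk' : (α : F) ^ k = y := by simpa using congrArg Units.val hk
    refine ⟨k % (2 * m), mem_range.mpr (Nat.mod_lt _ (by omega)), ?_⟩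
    rw [← ho, pow_mod_orderOf, ← hk']
    ring
  · rintro ⟨i, -, rfl⟩
    exact ⟨(α : F) ^ i, by ring⟩

variable [DecidableEq F]

/-- Each nonzero square is represented exactly once as `±α ^ (2 * j)` with `j < m`. -/
lemma sum_indicator_eq_ite_isSquare (hm : 0 < m) (hq : Fintype.card F = 4 * m + 1)
    (hα : ∀ x : Fˣ, x ∈ Subgroup.zpowers α) {h : F} (h0 : h ≠ 0) :
    ∑ j ∈ range m, ((if ((α : F) ^ 2) ^ j = h then 1 else 0) +
      (if -((α : F) ^ 2) ^ j = h then 1 else 0)) = if IsSquare h then 1 else 0 := by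
  have hneg := sq_pow_eq_neg_one_of_primitive hm hq hα
  have hsum : ∑ j ∈ range m, ((if ((α : F) ^ 2) ^ j = h then 1 else 0) +
      (if -((α : F) ^ 2) ^ j = h then 1 else 0)) =
      ∑ j ∈ range (2 * m), if ((α : F) ^ 2) ^ j = h then 1 else 0 := by
    rw [two_mul, sum_range_add, sum_add_distrib]
    simp only [pow_add _ m, hneg, neg_one_mul]
  rw [hsum]
  have hinj : Set.InjOn (fun i => ((α : F) ^ 2) ^ i) (range (2 * m)) := by
    have := pow_injOn_Iio_orderOf (x := (α : F) ^ 2)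
    rw [orderOf_sq_of_primitive hq hα] at this
    simpa using this
  rw [← sum_image (f := fun x => if x = h then 1 else 0) hinj, sum_ite_eq']
  simp only [mem_image, isSquare_iff_exists_sq_pow hm hq hα h0]

end PrimitiveElement

lemma card_filter_sub_eq_of_pairs {F : Type*} [Field F] [DecidableEq F]
    {x y : F} (hx : x ≠ -x) (hy : y ≠ -y) (g : F) :
    ((({x, -x} : Finset F) ×ˢ ({y, -y} : Finset F)).filter (fun p => p.1 - p.2 = g)).card =
      ((if x - y = g then 1 else 0) + (if -(x - y) = g then 1 else 0)) +
      ((if x + y = g then 1 else 0) + (if -(x + y) = g then 1 else 0)) := by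
  have h1 : -x - y = -(x + y) := by ring
  have h2 : -x + y = -(x - y) := by ring
  rw [card_filter, sum_product, sum_pair hx, sum_pair hy, sum_pair hy]
  simp only [sub_neg_eq_add, h1, h2]
  ring

lemma pair_cycShift_one {F : Type*} [Field F] [DecidableEq F] {m : ℕ} {a : F}
    (ha : a ^ m = -1) (j : Fin m) :
    ({a ^ (cycShift m 1 j).val, -a ^ (cycShift m 1 j).val} : Finset F) =
      {a ^ (j.val + 1), -a ^ (j.val + 1)} := by
  rcases Nat.lt_or_ge (j.val + 1) m with h | h
  · simp [cycShift, Nat.mod_eq_of_lt h]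
  · have hj : j.val + 1 = m := le_antisymm j.isLt h
    simp [cycShift, hj, ha, pair_comm]

lemma isSquare_xor_of_not_isSquare_mul {F : Type*} [Field F] [Fintype F] [DecidableEq F] {x y : F}
    (h : ¬ IsSquare (x * y)) : Xor (IsSquare x) (IsSquare y) := by
  by_cases hx : IsSquare x <;> by_cases hy : IsSquare y
  · exact absurd (hx.mul hy) h
  · exact Or.inl ⟨hx, hy⟩
  · exact Or.inr ⟨hy, hx⟩
  · rw [← quadraticChar_neg_one_iff_not_isSquare] at h hx hy
    rw [map_mul, hx, hy] at h
    norm_num at h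

/-- Let `q = 4m + 1` be a prime power (here: the order of a finite field `F`), `m ≥ 2`,
and let `α` be a primitive element of `F`. With `C_j = {α^{2j}, −α^{2j}}`,
the family `(C_0, …, C_{m−1})` is a `(q, m, 2; 1)`-`1`-CEDF in `(F, +)` if and only if
`α⁴ − 1` is not the square of any element of `F^×`. -/
theorem cedf_quadratic_criterion {F : Type*} [Field F] [Fintype F] [DecidableEq F]
    (m : ℕ) (hm : 2 ≤ m) (hq : Fintype.card F = 4 * m + 1)
    (α : Fˣ) (hα : ∀ x : Fˣ, x ∈ Subgroup.zpowers α) :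
    IsCEDF m 2 1 1
        (fun j : Fin m => ({(α : F) ^ (2 * j.val), -((α : F) ^ (2 * j.val))} : Finset F)) ↔
      ¬ ∃ y : Fˣ, (α : F) ^ 4 - 1 = (y : F) ^ 2 := by
  have hm0 : 0 < m := by omega
  have ho := orderOf_sq_of_primitive hq hα
  have hneg := sq_pow_eq_neg_one_of_primitive hm0 hq hα
  have h4 : (α : F) ^ 4 - 1 = ((α : F) ^ 2 - 1) * ((α : F) ^ 2 + 1) := by ring
  have h4ne : (α : F) ^ 4 - 1 ≠ 0 := by
    rw [sub_ne_zero, show (α : F) ^ 4 = ((α : F) ^ 2) ^ 2 by ring]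
    exact pow_ne_one_of_lt_orderOf two_ne_zero (by omega)
  have hsq : (∃ y : Fˣ, (α : F) ^ 4 - 1 = (y : F) ^ 2) ↔ IsSquare ((α : F) ^ 4 - 1) := by
    constructor
    · rintro ⟨y, hy⟩
      exact ⟨y, by rw [hy, sq]⟩
    · rintro ⟨y, hy⟩
      have hy0 : y ≠ 0 := by
        rintro rfl
        exact h4ne (by simpa using hy)
      exact ⟨Units.mk0 y hy0, by rw [hy, Units.val_mk0, sq]⟩
  rw [hsq, h4]
  rw [h4] at h4ne
  simp only [pow_mul]
  have ha0 : (α : F) ^ 2 ≠ 0 := pow_ne_zero _ α.ne_zero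
  set a : F := (α : F) ^ 2 with ha
  have hsub : a - 1 ≠ 0 := left_ne_zero_of_mul h4ne
  have hadd : a + 1 ≠ 0 := right_ne_zero_of_mul h4ne
  have hne (k : ℕ) : a ^ k ≠ -a ^ k := fun h =>
    mul_ne_zero (two_ne_zero_of_card hq) (pow_ne_zero k ha0) (by linear_combination h)
  have hinj {i j : ℕ} (hi : i < 2 * m) (hj : j < 2 * m) (h : a ^ i = a ^ j) : i = j :=
    pow_injOn_Iio_orderOf (by simpa [ho] using hi) (by simpa [ho] using hj) h
  have hcount (g : F) (hg : g ≠ 0) :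
      ∑ j : Fin m, ((({a ^ (cycShift m 1 j).val, -a ^ (cycShift m 1 j).val} : Finset F) ×ˢ
        ({a ^ j.val, -a ^ j.val} : Finset F)).filter (fun p => p.1 - p.2 = g)).card =
      (if IsSquare (g / (a - 1)) then 1 else 0) + (if IsSquare (g / (a + 1)) then 1 else 0) := by
    rw [← sum_indicator_eq_ite_isSquare hm0 hq hα (div_ne_zero hg hsub),
      ← sum_indicator_eq_ite_isSquare hm0 hq hα (div_ne_zero hg hadd), ← sum_add_distrib,
      ← Fin.sum_univ_eq_sum_range]
    refine sum_congr rfl fun j _ => ?_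
    have e1 : a ^ (j.val + 1) - a ^ j.val = a ^ j.val * (a - 1) := by ring
    have e2 : a ^ (j.val + 1) + a ^ j.val = a ^ j.val * (a + 1) := by ring
    rw [pair_cycShift_one hneg, card_filter_sub_eq_of_pairs (hne _) (hne _), e1, e2]
    simp only [eq_div_iff hsub, eq_div_iff hadd, neg_mul, ← ha]
  constructor
  · rintro ⟨-, -, h⟩ ⟨y, hy⟩
    have h1 := h (a - 1) hsub
    rw [hcount _ hsub, div_self hsub, if_pos IsSquare.one, if_pos] at h1
    · omega
    · exact ⟨y / (a + 1), by field_simp; linear_combination hy⟩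
  · intro hns
    refine ⟨fun i j hij => ?_, fun i => card_pair (hne _), fun g hg => ?_⟩
    · have hi := i.isLt
      have hj := j.isLt
      have hij' : i.val ≠ j.val := fun h => hij (Fin.ext h)
      have key1 : a ^ i.val ≠ a ^ j.val := fun h => hij' (hinj (by omega) (by omega) h)
      have key2 : a ^ i.val ≠ -a ^ j.val := fun h => by
        have := hinj (i := i.val) (j := m + j.val) (by omega) (by omega)
          (by rw [pow_add, hneg, h, neg_one_mul])
        omega
      have key3 : -a ^ i.val ≠ a ^ j.val := fun h => key2 (by rw [← h, neg_neg])
      simp [key1.symm, key3.symm, neg_eq_iff_eq_neg, key2.symm]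
    · rw [hcount g hg]
      have hns' : ¬ IsSquare (g / (a - 1) * (g / (a + 1))) := by
        rintro ⟨z, hz⟩
        have hz' : g * g = z * z * ((a - 1) * (a + 1)) := by
          rw [← hz]
          field_simp
        have hz0 : z ≠ 0 := by
          rintro rfl
          exact mul_ne_zero hg hg (by simpa using hz')
        exact hns ⟨g / z, by field_simp; linear_combination -hz'⟩
      rcases isSquare_xor_of_not_isSquare_mul hns' with ⟨h1, h2⟩ | ⟨h1, h2⟩ <;> simp [h1, h2]
end

section
/- Suppose q = m·ℓ² + 1 is a prime power with m ≥ 2 and ℓ ≥ 2, let α be a primitive element of the finite field F_q, set β = α^ℓ, and let H be the subgroup of F_q^× of order ℓ·m generated by β. For 0 ≤ j ≤ m−1, define C_j = {β^{i·m + j} : 0 ≤ i ≤ ℓ−1}. Then the family (C_0, …, C_{m−1}) is a (q, m, ℓ; 1)-1-circular external difference family in the additive group of F_q if and only if the set {β − 1, β^{m+1} − 1, …, β^{(ℓ−1)m+1} − 1} (i.e., {β^{i·m+1} − 1 : 0 ≤ i ≤ ℓ−1}) is a complete set of coset representatives of H in F_q^× (i.e., the ℓ elements β^{i·m+1} − 1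 are nonzero and lie in pairwise distinct cosets of H, and every coset of H in F_q^× contains exactly one of them — note [F_q^× : H] = ℓ). -/
open Finset

section CosetCriterion

variable {F : Type*} [Field F] {m ℓ : ℕ} {β : Fˣ}

theorem mem_image_pow_iff [DecidableEq F] (hℓ : 0 < ℓ) (hβ : orderOf β = m * ℓ) {j : ℕ}
    (hj : j < m) (x : F) :
    x ∈ (range ℓ).image (fun i => (β : F) ^ (i * m + j)) ↔
      ∃ k : ℕ, k % m = j ∧ (β : F) ^ k = x := by
  simp only [mem_image, mem_range]
  constructor
  · rintro ⟨i, -, rfl⟩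
    exact ⟨i * m + j, by rw [Nat.mul_add_mod_self_right, Nat.mod_eq_of_lt hj], rfl⟩
  · rintro ⟨k, rfl, rfl⟩
    refine ⟨k / m % ℓ, Nat.mod_lt _ hℓ, ?_⟩
    have h : k / m % ℓ * m + k % m = k % orderOf β := by
      rw [hβ, Nat.mod_mul]; ring
    rw [h, ← Units.val_pow_eq_pow_val, pow_mod_orderOf, Units.val_pow_eq_pow_val]

theorem mod_eq_of_unit_pow_eq (hβ : orderOf β = m * ℓ) {a b : ℕ}
    (h : (β : F) ^ a = (β : F) ^ b) : a % m = b % m := by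
  have h' : β ^ a = β ^ b := Units.ext (by simpa using h)
  rw [pow_eq_pow_iff_modEq, hβ] at h'
  exact h'.of_mul_right ℓ

theorem eq_of_unit_pow_mul_add_eq (hβ : orderOf β = m * ℓ) {j : ℕ} (hj : j < m) {a b : ℕ}
    (ha : a < ℓ) (hb : b < ℓ) (h : (β : F) ^ (a * m + j) = (β : F) ^ (b * m + j)) :
    a = b := by
  have h' : β ^ (a * m + j) = β ^ (b * m + j) := Units.ext (by simpa using h)
  rw [pow_eq_pow_iff_modEq, hβ] at h'
  have hmod : a * m ≡ b * m [MOD m * ℓ] := Nat.ModEq.add_right_cancel' j h'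
  have hlt : ∀ c < ℓ, c * m < m * ℓ := fun c hc => by
    rw [mul_comm]; exact Nat.mul_lt_mul_of_pos_left hc (by omega)
  exact Nat.eq_of_mul_eq_mul_right (by omega)
    (Nat.ModEq.eq_of_lt_of_lt hmod (hlt a ha) (hlt b hb))

theorem exists_mul_pow_of_mem_consecutive (hm : 2 ≤ m) (hℓ : 0 < ℓ)
    (hβ : orderOf β = m * ℓ) {k l : ℕ} (h : k % m = (l % m + 1) % m) :
    ∃ i < ℓ, (β : F) ^ k = (β : F) ^ l * (β : F) ^ (i * m + 1) := by
  classical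
  have hN : 0 < m * ℓ := Nat.mul_pos (by omega) hℓ
  obtain ⟨t, ht⟩ : ∃ t, t + l = k + m * ℓ * l :=
    Nat.exists_eq_add_of_le' (by nlinarith) |>.imp fun _ h => h.symm
  have htm : t % m = 1 := by
    have h1 : t + l ≡ 1 + l [MOD m] := by
      rw [ht, Nat.ModEq, mul_assoc, Nat.add_mul_mod_self_left, h, Nat.mod_add_mod, add_comm]
    have h2 : t % m = 1 % m := Nat.ModEq.add_right_cancel' l h1
    rwa [Nat.mod_eq_of_lt (by omega : 1 < m)] at h2
  obtain ⟨i, hi, hit⟩ := mem_image.1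
    ((mem_image_pow_iff hℓ hβ (by omega : 1 < m) _).2 ⟨t, htm, rfl⟩)
  refine ⟨i, mem_range.1 hi, ?_⟩
  rw [hit, ← pow_add, add_comm, ht, pow_add, pow_mul, ← hβ,
    ← Units.val_pow_eq_pow_val β (orderOf β), pow_orderOf_eq_one, Units.val_one, one_pow, mul_one]

open Classical in
/-- For `g ≠ 0`, the representations of `g` as an external difference of consecutive classes
correspond to the elements `β ^ (i * m + 1) - 1` lying in the coset of `g` modulo `⟨β⟩`. -/
theorem sum_card_sub_eq_card_coset [DecidableEq F] [Finite Fˣ] (hm : 2 ≤ m) (hℓ : 0 < ℓ)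
    (hβ : orderOf β = m * ℓ) (g : Fˣ) :
    ∑ j : Fin m,
      ((((range ℓ).image fun i => (β : F) ^ (i * m + (cycShift m 1 j).val)) ×ˢ
        ((range ℓ).image fun i => (β : F) ^ (i * m + j.val))).filter
          (fun p => p.1 - p.2 = (g : F))).card =
      (univ.filter fun i : Fin ℓ => ∃ h ∈ Subgroup.zpowers β,
        (β : F) ^ (i.val * m + 1) - 1 = (g : F) * ((h : Fˣ) : F)).card := by
  have hm0 : 0 < m := by omega
  rw [← card_sigma]
  have key : ∀ s ∈ univ.sigma (fun j : Fin m =>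
      (((range ℓ).image fun i => (β : F) ^ (i * m + (cycShift m 1 j).val)) ×ˢ
        ((range ℓ).image fun i => (β : F) ^ (i * m + j.val))).filter
          (fun p => p.1 - p.2 = (g : F))),
      ∃ i : Fin ℓ, ∃ l : ℕ, l % m = s.1.val ∧ s.2.2 = (β : F) ^ l ∧
        s.2.1 = (β : F) ^ l * (β : F) ^ (i.val * m + 1) ∧
        (β : F) ^ l * ((β : F) ^ (i.val * m + 1) - 1) = g := by
    rintro ⟨j, x, y⟩ hs
    simp only [mem_sigma, mem_univ, true_and, mem_filter, mem_product] at hs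
    obtain ⟨⟨hx, hy⟩, hg⟩ := hs
    obtain ⟨k, hk, rfl⟩ := (mem_image_pow_iff hℓ hβ (cycShift m 1 j).isLt x).1 hx
    obtain ⟨l, hl, rfl⟩ := (mem_image_pow_iff hℓ hβ j.isLt y).1 hy
    obtain ⟨i, hi, h⟩ := exists_mul_pow_of_mem_consecutive (F := F) hm hℓ hβ
      (k := k) (l := l) (by rw [hk, hl]; rfl)
    refine ⟨⟨i, hi⟩, l, hl, rfl, h, ?_⟩
    rw [← hg, h]; ring
  choose f hf using key
  refine card_bij f ?_ ?_ ?_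
  · intro s hs
    obtain ⟨l, -, -, -, h⟩ := hf s hs
    refine mem_filter.2 ⟨mem_univ _, (β ^ l)⁻¹,
      inv_mem (pow_mem (Subgroup.mem_zpowers β) l), ?_⟩
    rw [← h, Units.val_inv_eq_inv_val, Units.val_pow_eq_pow_val]
    have : (β : F) ^ l ≠ 0 := pow_ne_zero _ β.ne_zero
    field_simp
  · rintro ⟨j, x, y⟩ hs ⟨j', x', y'⟩ hs' heq
    obtain ⟨l, hl, hy, hx, h⟩ := hf _ hs
    obtain ⟨l', hl', hy', hx', h'⟩ := hf _ hs'
    rw [← heq] at hx' h'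
    dsimp only at hl hy hx hl' hy' hx'
    have hne : (β : F) ^ ((f _ hs).val * m + 1) - 1 ≠ 0 := fun h0 =>
      g.ne_zero (by rw [← h, h0, mul_zero])
    have hll : (β : F) ^ l = (β : F) ^ l' := mul_right_cancel₀ hne (h.trans h'.symm)
    have hj : j = j' := Fin.ext (by rw [← hl, ← hl', mod_eq_of_unit_pow_eq hβ hll])
    subst hj
    have hyy : y = y' := by rw [hy, hy', hll]
    have hxx : x = x' := by rw [hx', ← hll]; exact hx
    rw [hxx, hyy]
  · intro i hi
    obtain ⟨h, hh, hi⟩ := (mem_filter.1 hi).2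
    obtain ⟨l, hl⟩ := mem_zpowers_iff_mem_range_orderOf.1 (inv_mem hh) |> mem_image.1
    have hg : (β : F) ^ l * ((β : F) ^ (i.val * m + 1) - 1) = g := by
      rw [hi, ← Units.val_pow_eq_pow_val, hl.2, Units.val_inv_eq_inv_val]
      have := h.ne_zero
      field_simp
    have hs : (⟨⟨l % m, Nat.mod_lt _ hm0⟩, (β : F) ^ (l + (i.val * m + 1)), (β : F) ^ l⟩ :
        Σ _ : Fin m, F × F) ∈ univ.sigma (fun j : Fin m =>
      (((range ℓ).image fun i => (β : F) ^ (i * m + (cycShift m 1 j).val)) ×ˢ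
        ((range ℓ).image fun i => (β : F) ^ (i * m + j.val))).filter
          (fun p => p.1 - p.2 = (g : F))) := by
      simp only [mem_sigma, mem_univ, true_and, mem_filter, mem_product]
      refine ⟨⟨(mem_image_pow_iff hℓ hβ (Fin.isLt _) _).2 ⟨_, ?_, rfl⟩,
        (mem_image_pow_iff hℓ hβ (Nat.mod_lt _ hm0) _).2 ⟨l, rfl, rfl⟩⟩, ?_⟩
      · simp only [cycShift]
        rw [Nat.mod_add_mod, show l + (i.val * m + 1) = l + 1 + i.val * m by ring,
          Nat.add_mul_mod_self_right]
      · rw [← hg]; ring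
    refine ⟨_, hs, ?_⟩
    obtain ⟨l', -, hy, hx, -⟩ := hf _ hs
    dsimp only at hy hx
    rw [← hy] at hx
    exact Fin.ext (eq_of_unit_pow_mul_add_eq hβ (by omega) (Fin.isLt _) (Fin.isLt _)
      (mul_left_cancel₀ (pow_ne_zero l β.ne_zero) (hx.symm.trans (pow_add _ _ _))))

end CosetCriterion

/-- Let `q = m·ℓ² + 1` be the order of a finite field `F` with `m ≥ 2`, `ℓ ≥ 2`, let `α`
be a primitive element of `F`, `β = α^ℓ`, and let `H = ⟨β⟩ ≤ F^×` (the subgroup of order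
`ℓ·m` generated by `β`). With `C_j = {β^{i·m + j} : 0 ≤ i ≤ ℓ−1}`, the family
`(C_0, …, C_{m−1})` is a `(q, m, ℓ; 1)`-`1`-CEDF in `(F, +)` if and only if
`{β^{i·m+1} − 1 : 0 ≤ i ≤ ℓ−1}` is a complete set of coset representatives of `H`
in `F^×` (every coset of `H` contains exactly one of these elements). -/
theorem cedf_coset_representative_criterion {F : Type*} [Field F] [Fintype F] [DecidableEq F]
    (m ℓ : ℕ) (hm : 2 ≤ m) (hℓ : 2 ≤ ℓ) (hq : Fintype.card F = m * ℓ ^ 2 + 1)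
    (α : Fˣ) (hα : ∀ x : Fˣ, x ∈ Subgroup.zpowers α) :
    IsCEDF m ℓ 1 1
        (fun j : Fin m =>
          (Finset.range ℓ).image (fun i => ((α ^ ℓ : Fˣ) : F) ^ (i * m + j.val))) ↔
      (∀ x : Fˣ, ∃! i : Fin ℓ,
        ∃ h ∈ Subgroup.zpowers (α ^ ℓ),
          ((α ^ ℓ : Fˣ) : F) ^ (i.val * m + 1) - 1 = (x : F) * ((h : Fˣ) : F)) := by
  classical
  have hℓ0 : 0 < ℓ := by omega
  have hβ : orderOf (α ^ ℓ) = m * ℓ := by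
    have h : orderOf α = m * ℓ * ℓ := by
      rw [orderOf_eq_card_of_forall_mem_zpowers hα, Nat.card_eq_fintype_card,
        Fintype.card_units, hq, Nat.add_sub_cancel]
      ring
    rw [orderOf_pow_of_dvd hℓ0.ne' (h ▸ Nat.dvd_mul_left ℓ _), h, Nat.mul_div_cancel _ hℓ0]
  have hcount : ∀ x : Fˣ, (∃! i : Fin ℓ, ∃ h ∈ Subgroup.zpowers (α ^ ℓ),
      ((α ^ ℓ : Fˣ) : F) ^ (i.val * m + 1) - 1 = (x : F) * ((h : Fˣ) : F)) ↔
      ∑ j : Fin m,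
        ((((range ℓ).image fun i => ((α ^ ℓ : Fˣ) : F) ^ (i * m + (cycShift m 1 j).val)) ×ˢ
          ((range ℓ).image fun i => ((α ^ ℓ : Fˣ) : F) ^ (i * m + j.val))).filter
            (fun p => p.1 - p.2 = (x : F))).card = 1 := by
    intro x
    rw [sum_card_sub_eq_card_coset hm hℓ0 hβ x, Fintype.existsUnique_iff_card_one]
    congr!
  simp only [hcount]
  constructor
  · rintro ⟨-, -, h⟩ x
    exact h x x.ne_zero
  · refine fun h => ⟨fun i j hij => ?_, fun j => ?_, fun g hg => h (Units.mk0 g hg)⟩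
    · rw [disjoint_left]
      intro x hx hy
      obtain ⟨k, hk, rfl⟩ := (mem_image_pow_iff hℓ0 hβ i.isLt x).1 hx
      obtain ⟨l, hl, hlk⟩ := (mem_image_pow_iff hℓ0 hβ j.isLt _).1 hy
      exact hij (Fin.ext (by rw [← hk, ← hl, mod_eq_of_unit_pow_eq hβ hlk]))
    · rw [card_image_of_injOn, card_range]
      intro a ha b hb hab
      exact eq_of_unit_pow_mul_add_eq hβ j.isLt (by simpa using ha) (by simpa using hb) hab
end

section
/- Let G be a finite additive abelian group of order n and suppose (A_0, …, A_{m−1}) is an (n, m, ℓ; λ)-1-circular external difference family in G. Let c be an integer with 1 < c < m and gcd(c, m) = 1. Then the family (A'_0, …, A'_{m−1}) defined by A'_i = A_{(i·c^{-1}) mod m} (where c^{-1} is the multiplicative inverse of c modulo m) is an (n, m, ℓ; λ)-c-circular external difference family in G; in particular, an (n, m, ℓ; λ)-c-CEDF exists whenever an (n, m, ℓ; λ)-1-CEDF exists and gcd(c, m) = 1. -/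
open Finset

/-- Multiplication by a unit `d` modulo `m` is injective on `Fin m`. -/
theorem mul_mod_fin_injective {m d : ℕ} (hd : Nat.Coprime m d) :
    Function.Injective
      (fun i : Fin m => (⟨(i.val * d) % m, Nat.mod_lt _ i.pos⟩ : Fin m)) := by
  intro i j hij
  have h : i.val * d ≡ j.val * d [MOD m] := congrArg Fin.val hij
  exact Fin.ext ((h.cancel_right_of_coprime hd).eq_of_lt_of_lt i.isLt j.isLt)

/-- If `c * d ≡ 1` modulo `m`, multiplication by `d` turns a shift by `c` into a shift by `1`. -/
theorem mul_mod_cycShift {m c d : ℕ} (hd : c * d ≡ 1 [MOD m]) (j : Fin m) :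
    (⟨((cycShift m c j).val * d) % m, Nat.mod_lt _ j.pos⟩ : Fin m) =
      cycShift m 1 ⟨(j.val * d) % m, Nat.mod_lt _ j.pos⟩ := by
  apply Fin.ext
  change (j.val + c) % m * d ≡ j.val * d % m + 1 [MOD m]
  calc (j.val + c) % m * d ≡ (j.val + c) * d [MOD m] := (Nat.mod_modEq _ _).mul_right d
    _ = j.val * d + c * d := add_mul _ _ _
    _ ≡ j.val * d % m + 1 [MOD m] := (Nat.mod_modEq _ _).symm.add hd

/-- If `(A_0, …, A_{m−1})` is an `(n, m, ℓ; λ)`-`1`-CEDF, `1 < c < m` with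
`gcd(c, m) = 1`, and `d` is the multiplicative inverse of `c` modulo `m`, then the
family `A'_i = A_{(i·d) mod m}` is an `(n, m, ℓ; λ)`-`c`-CEDF. In particular an
`(n, m, ℓ; λ)`-`c`-CEDF exists whenever an `(n, m, ℓ; λ)`-`1`-CEDF exists. -/
theorem cedf_of_one_cedf_coprime {G : Type*} [AddCommGroup G] [DecidableEq G]
    (m ℓ lam c d : ℕ) (hc1 : 1 < c) (hc2 : c < m)
    (hgcd : Nat.gcd c m = 1) (hd : (c * d) % m = 1)
    (A : Fin m → Finset G) (hA : IsCEDF m ℓ lam 1 A) :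
    IsCEDF m ℓ lam c (fun i : Fin m => A ⟨(i.val * d) % m, Nat.mod_lt _ i.pos⟩) := by
  have hmod : c * d ≡ 1 [MOD m] := hd.trans (Nat.mod_eq_of_lt (hc1.trans hc2)).symm
  have hcop : Nat.Coprime m d := by
    have h : Nat.gcd (c * d) m = 1 := hmod.gcd_eq.trans (Nat.gcd_one_left m)
    exact (Nat.Coprime.coprime_mul_left h).symm
  have hinj := mul_mod_fin_injective hcop
  obtain ⟨hdisj, hcard, hsum⟩ := hA
  refine ⟨fun i j hij => hdisj _ _ (hinj.ne hij), fun i => hcard _, fun g hg => ?_⟩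
  rw [← hsum g hg]
  refine Fintype.sum_bijective _ (Finite.injective_iff_bijective.mp hinj) _ _ fun j => ?_
  simp only [mul_mod_cycShift hmod]
end

section
/- Let G be a finite additive abelian group of order n ≥ 2, let A_0, …, A_{m−1} be m pairwise disjoint ℓ-element subsets of G, and let c be an integer with 1 ≤ c ≤ m−1. For each nonzero Δ ∈ G define N(Δ) to be the number of pairs (i, x) with 0 ≤ i ≤ m−1, x ∈ A_i, and x + Δ ∈ A_{(i+c) mod m}. Then there exists a nonzero Δ ∈ G with (n − 1)·N(Δ) ≥ m·ℓ²; equivalently, the maximum over nonzero Δ of N(Δ)/(m·ℓ) is at least ℓ/(n − 1). -/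
open Finset

theorem cycShift_ne {m c : ℕ} (hc1 : 1 ≤ c) (hc2 : c ≤ m - 1) (i : Fin m) :
    cycShift m c i ≠ i := by
  intro h
  have h1 : (i.val + c) % m = i.val := congrArg Fin.val h
  have hi := i.isLt
  rcases lt_or_ge (i.val + c) m with h2 | h2
  · rw [Nat.mod_eq_of_lt h2] at h1
    omega
  · rw [Nat.mod_eq_sub_mod h2, Nat.mod_eq_of_lt (by omega)] at h1
    omega

/-- Summing over all translations `Δ` the number of `x ∈ s` with `x + Δ ∈ t` counts all pairs in
`s × t`. -/
theorem sum_card_filter_add_mem {G : Type*} [AddCommGroup G] [Fintype G] [DecidableEq G]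
    (s t : Finset G) :
    ∑ Δ : G, (s.filter (fun x => x + Δ ∈ t)).card = s.card * t.card := by
  have key (x : G) : (∑ Δ : G, if x + Δ ∈ t then 1 else 0) = t.card := by
    refine (Equiv.sum_comp (Equiv.addLeft x) (fun y => if y ∈ t then 1 else 0)).trans ?_
    simp
  simp_rw [Finset.card_filter]
  rw [Finset.sum_comm, Finset.sum_congr rfl fun x _ => key x]
  simp

/-- Let `A_0, …, A_{m−1}` be pairwise disjoint `ℓ`-element subsets of a finite abelian
group `G` of order `n ≥ 2`, and let `1 ≤ c ≤ m−1`. For nonzero `Δ`, let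
`N(Δ) = #{(i, x) : x ∈ A_i, x + Δ ∈ A_{(i+c) mod m}}`. Then there exists a nonzero `Δ`
with `(n − 1)·N(Δ) ≥ m·ℓ²` (equivalently, `max_{Δ ≠ 0} N(Δ)/(mℓ) ≥ ℓ/(n−1)`). -/
theorem exists_tamper_count_ge {G : Type*} [AddCommGroup G] [Fintype G] [DecidableEq G]
    (n m ℓ c : ℕ) (hn : Fintype.card G = n) (hn2 : 2 ≤ n)
    (hc1 : 1 ≤ c) (hc2 : c ≤ m - 1)
    (A : Fin m → Finset G)
    (hdisj : ∀ i j : Fin m, i ≠ j → Disjoint (A i) (A j))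
    (hcard : ∀ i, (A i).card = ℓ) :
    ∃ Δ : G, Δ ≠ 0 ∧
      m * ℓ ^ 2 ≤
        (n - 1) * (∑ i : Fin m, ((A i).filter (fun x => x + Δ ∈ A (cycShift m c i))).card) := by
  by_contra! hlt
  set N : G → ℕ := fun Δ =>
    ∑ i : Fin m, ((A i).filter (fun x => x + Δ ∈ A (cycShift m c i))).card with hN
  have htotal : ∑ Δ : G, N Δ = m * ℓ ^ 2 := by
    rw [hN, Finset.sum_comm]
    simp [sum_card_filter_add_mem, hcard, sq]
  have hzero : N 0 = 0 := by
    refine Finset.sum_eq_zero fun i _ => ?_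
    rw [Finset.card_eq_zero, Finset.filter_eq_empty_iff]
    intro x hx
    rw [add_zero]
    exact Finset.disjoint_left.mp (hdisj i _ (cycShift_ne hc1 hc2 i).symm) hx
  have hcard_erase : (univ.erase (0 : G)).card = n - 1 := by
    rw [Finset.card_erase_of_mem (mem_univ _), Finset.card_univ, hn]
  have hsum : ∑ Δ ∈ univ.erase (0 : G), N Δ = m * ℓ ^ 2 := by
    rw [← htotal, Finset.sum_erase _ hzero]
  have hne : (univ.erase (0 : G)).Nonempty := by
    rw [← Finset.card_pos, hcard_erase]
    omega
  have hstrict : ∑ Δ ∈ univ.erase (0 : G), (n - 1) * N Δ <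
      ∑ _Δ ∈ univ.erase (0 : G), m * ℓ ^ 2 :=
    Finset.sum_lt_sum_of_nonempty hne fun Δ hΔ => hlt Δ (Finset.ne_of_mem_erase hΔ)
  rw [← Finset.mul_sum, hsum, Finset.sum_const, hcard_erase, smul_eq_mul] at hstrict
  exact lt_irrefl _ hstrict
end

section
/- Suppose q = m·ℓ² + 1 is a prime power with m ≥ 2 and ℓ ≥ 2, let α be a primitive element of F_q, set β = α^ℓ, and for 0 ≤ j ≤ m−1 define C_j = {β^{i·m + j} : 0 ≤ i ≤ ℓ−1}. Let E be the multiset {β^{i₁·m + 1} − β^{i₂·m} : 0 ≤ i₁, i₂ ≤ ℓ−1} and B = {β^j : 0 ≤ j ≤ m−1}. Then the multiset union ⋃_{j=0}^{m−1} D(C_{(j+1) mod m}, C_j) equals the multiset E ⊗ B = {e·b : e ∈ E, b ∈ B}, and moreover E ⊗ B equals the multiset {β^{i·m+1} − 1 : 0 ≤ i ≤ ℓ−1} ⊗ H, where H = {β^i : 0 ≤ i ≤ ℓm − 1} is the subgroup of F_q^× generated by β. -/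
open Finset

theorem Finset.sum_range_add_of_periodic {M : Type*} [AddCancelCommMonoid M] {f : ℕ → M} {n : ℕ}
    (hf : Function.Periodic f n) (k : ℕ) :
    ∑ i ∈ Finset.range n, f (i + k) = ∑ i ∈ Finset.range n, f i := by
  induction k with
  | zero => rfl
  | succ k ih =>
    rw [← ih]
    have h := Finset.sum_range_succ' (fun i => f (i + k)) n
    rw [Finset.sum_range_succ] at h
    have h0 : f (n + k) = f (0 + k) := by rw [add_comm n k, hf, zero_add]
    rw [h0] at h
    rw [add_right_cancel h]
    exact Finset.sum_congr rfl fun i _ => by rw [add_right_comm, add_assoc]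

theorem Finset.sum_range_mul_eq_sum_sum {M : Type*} [AddCommMonoid M] (f : ℕ → M) (a b : ℕ) :
    ∑ i ∈ Finset.range (a * b), f i =
      ∑ i ∈ Finset.range a, ∑ j ∈ Finset.range b, f (i * b + j) := by
  induction a with
  | zero => simp
  | succ a ih => rw [Nat.succ_mul, Finset.sum_range_add, ih, Finset.sum_range_succ]

theorem Finset.map_val_eq_sum_singleton {ι M : Type*} (s : Finset ι) (f : ι → M) :
    s.val.map f = ∑ i ∈ s, {f i} := by
  rw [← Multiset.sum_map_singleton (s.val.map f), Multiset.map_map]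
  rfl

theorem Multiset.bind_map_mul_map {ι κ M : Type*} [Mul M] (s : Finset ι) (t : Finset κ)
    (f : ι → M) (g : κ → M) :
    ((s.val.map f).bind fun u => (t.val.map g).map fun v => u * v) =
      ∑ i ∈ s, ∑ j ∈ t, {f i * g j} := by
  rw [Multiset.bind_map]
  simp only [Multiset.map_map, Function.comp_def]
  simp only [Finset.map_val_eq_sum_singleton]
  rfl

theorem orderOf_pow_of_forall_mem_zpowers {F : Type*} [Field F] [Fintype F] {m l : ℕ} (hl : l ≠ 0)
    (hq : Fintype.card F = m * l ^ 2 + 1) {a : Fˣ} (ha : ∀ x : Fˣ, x ∈ Subgroup.zpowers a) :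
    orderOf ((a : F) ^ l) = l * m := by
  have hord : orderOf a = (l * m) * l := by
    rw [orderOf_eq_card_of_forall_mem_zpowers ha, Nat.card_units, Nat.card_eq_fintype_card, hq,
      Nat.add_sub_cancel]
    ring
  rw [← Units.val_pow_eq_pow_val, orderOf_units, orderOf_pow_of_dvd hl ⟨l * m, by rw [hord]; ring⟩,
    hord, Nat.mul_div_cancel _ (Nat.pos_of_ne_zero hl)]

/-- Let `q = m·ℓ² + 1` be the order of a finite field `F` (`m ≥ 2`, `ℓ ≥ 2`), `α` a
primitive element, `β = α^ℓ`, and `C_j = {β^{i·m+j} : 0 ≤ i ≤ ℓ−1}`. With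
`E = {β^{i₁·m+1} − β^{i₂·m} : 0 ≤ i₁, i₂ ≤ ℓ−1}` and `B = {β^j : 0 ≤ j ≤ m−1}`
(as multisets), the multiset union `⋃_j D(C_{(j+1) mod m}, C_j)` equals `E ⊗ B`, and
`E ⊗ B = {β^{i·m+1} − 1 : 0 ≤ i ≤ ℓ−1} ⊗ H`, where `H = {β^i : 0 ≤ i ≤ ℓm−1}` is the
subgroup of `F^×` generated by `β`. -/
theorem cedf_difference_multiset_factorization {F : Type*} [Field F] [Fintype F]
    [DecidableEq F]
    (m ℓ : ℕ) (hm : 2 ≤ m) (hℓ : 2 ≤ ℓ) (hq : Fintype.card F = m * ℓ ^ 2 + 1)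
    (α : Fˣ) (hα : ∀ x : Fˣ, x ∈ Subgroup.zpowers α) :
    let β : F := (α : F) ^ ℓ
    let C : Fin m → Finset F := fun j => (Finset.range ℓ).image (fun i => β ^ (i * m + j.val))
    let otimes : Multiset F → Multiset F → Multiset F :=
      fun X Y => X.bind (fun u => Y.map (fun v => u * v))
    let E : Multiset F :=
      ((Finset.range ℓ ×ˢ Finset.range ℓ).val).map
        (fun p => β ^ (p.1 * m + 1) - β ^ (p.2 * m))
    let B : Multiset F := ((Finset.range m).val).map (fun j => β ^ j)
    let H : Multiset F := ((Finset.range (ℓ * m)).val).map (fun i => β ^ i)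
    let E' : Multiset F := ((Finset.range ℓ).val).map (fun i => β ^ (i * m + 1) - 1)
    ((∑ j : Fin m, ((C (cycShift m 1 j) ×ˢ C j).val).map (fun p : F × F => p.1 - p.2))
        = otimes E B) ∧
      otimes E B = otimes E' H := by
  intro β C otimes E B H E'
  have hord : orderOf β = ℓ * m := orderOf_pow_of_forall_mem_zpowers (by omega) hq hα
  have hβ : β ≠ 0 := pow_ne_zero _ α.ne_zero
  have hpow : β ^ (ℓ * m) = 1 := hord ▸ pow_orderOf_eq_one β
  have hinj (k : ℕ) : Set.InjOn (fun i => β ^ (i * m + k)) (Finset.range ℓ) := by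
    intro i hi i' hi' h
    simp only [Finset.coe_range, Set.mem_Iio] at hi hi'
    simp only [pow_add] at h
    have h' := pow_injOn_Iio_orderOf
      (by rw [hord, Set.mem_Iio]; gcongr) (by rw [hord, Set.mem_Iio]; gcongr)
      (mul_right_cancel₀ (pow_ne_zero k hβ) h)
    exact Nat.eq_of_mul_eq_mul_right (by omega) h'
  have hper (k : ℕ) (g : F → Multiset F) :
      Function.Periodic (fun i => g (β ^ (i * m + k))) ℓ := fun i => by
    simp only [add_mul, add_right_comm _ (ℓ * m), pow_add _ _ (ℓ * m), hpow, mul_one]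
  have hsum (k : ℕ) (g : F → Multiset F) :
      ∑ x ∈ (Finset.range ℓ).image (fun i => β ^ (i * m + k)), g x =
        ∑ i ∈ Finset.range ℓ, g (β ^ (i * m + k)) := Finset.sum_image (hinj k)
  have hshift (j : Fin m) (g : F → Multiset F) :
      ∑ i ∈ Finset.range ℓ, g (β ^ (i * m + (j.val + 1) % m)) =
        ∑ i ∈ Finset.range ℓ, g (β ^ (i * m + (j.val + 1))) := by
    rcases Nat.lt_or_ge (j.val + 1) m with h | h
    · rw [Nat.mod_eq_of_lt h]
    · have h' : j.val + 1 = m := by omega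
      rw [h', Nat.mod_self, ← Finset.sum_range_add_of_periodic (hper 0 g) 1]
      simp only [add_mul, one_mul, add_zero]
  have hEB : otimes E B = ∑ j ∈ Finset.range m, ∑ i₁ ∈ Finset.range ℓ, ∑ i₂ ∈ Finset.range ℓ,
      {(β ^ (i₁ * m + 1) - β ^ (i₂ * m)) * β ^ j} := by
    simp only [otimes, E, B, Multiset.bind_map_mul_map]
    rw [Finset.sum_comm]
    simp only [Finset.sum_product]
  constructor
  · rw [hEB, Finset.sum_range]
    refine Finset.sum_congr rfl fun j _ => ?_
    rw [Finset.map_val_eq_sum_singleton, Finset.sum_product]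
    simp only [C, hsum, cycShift]
    rw [hshift j fun x => ∑ i ∈ Finset.range ℓ, {x - β ^ (i * m + j.val)}]
    refine Finset.sum_congr rfl fun i₁ _ => Finset.sum_congr rfl fun i₂ _ => ?_
    congr 1
    ring
  · have hEH : otimes E' H = ∑ i₂ ∈ Finset.range ℓ, ∑ j ∈ Finset.range m, ∑ i ∈ Finset.range ℓ,
        {(β ^ (i * m + 1) - 1) * β ^ (i₂ * m + j)} := by
      simp only [otimes, E', H, Multiset.bind_map_mul_map]
      rw [Finset.sum_comm, Finset.sum_range_mul_eq_sum_sum]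
    rw [hEB, hEH, Finset.sum_comm (s := Finset.range ℓ) (t := Finset.range m)]
    refine Finset.sum_congr rfl fun j _ => ?_
    rw [Finset.sum_comm]
    refine Finset.sum_congr rfl fun i₂ _ => ?_
    rw [← Finset.sum_range_add_of_periodic
      (hper 1 fun x => {(x - β ^ (i₂ * m)) * β ^ j}) i₂]
    refine Finset.sum_congr rfl fun i _ => ?_
    congr 1
    ring
end
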